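/- arXiv:2205.05133 — 2 statements merged into one kernel-verified Lean document; each statement's English description precedes it below -/
import Mathlib

section
/- In the trinomial weak-information setup with horizon n: for every 0 ≤ m < n and all naturals i, j with i + j ≤ m such that P^ν(U_m = i ∧ M_m = j) > 0, the transition probability of an up-move satisfies P^ν(ω(m) = 0 ∧ U_m = i ∧ M_m = j) / P^ν(U_m = i ∧ M_m = j) = [Σ_{(h,k) : h+k ≤ n, i+1 ≤ h, j ≤ k, (h-i-1)+(k-j) ≤ n-m-1} ν(h,k) · C(m; i, j) · C(n-m-1; h-i-1, k-j) / C(n; h, k)] / [Σ_{(h,k) : h+k ≤ n, i ≤ h, j ≤ k, (h-i)+(k-j) ≤ n-m} ν(h,k) · C(m; i, j) · C(n-m; h-i, k-j) / C(n; h, k)]. -/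
open Finset

/-- The trinomial coefficient `m! / (i! j! (m-i-j)!)` (for `i + j ≤ m`). -/
def triCoeff (m i j : ℕ) : ℕ :=
  m.factorial / (i.factorial * j.factorial * (m - i - j).factorial)

/-- Number of up-moves (value `0`) among the first `m` steps of `ω`. -/
def upCount (n m : ℕ) (ω : Fin n → Fin 3) : ℕ :=
  (univ.filter (fun j : Fin n => (j : ℕ) < m ∧ ω j = 0)).card

/-- Number of middle-moves (value `1`) among the first `m` steps of `ω`. -/
def midCount (n m : ℕ) (ω : Fin n → Fin 3) : ℕ :=
  (univ.filter (fun j : Fin n => (j : ℕ) < m ∧ ω j = 1)).card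

/-- The product probability weight of a trinomial path `ω`, each step having weights
`(p₁, p₂, p₃)`. -/
noncomputable def triWeight (n : ℕ) (p₁ p₂ p₃ : ℝ) (ω : Fin n → Fin 3) : ℝ :=
  ∏ j, ![p₁, p₂, p₃] (ω j)

/-- The minimal probability measure associated with the weak information `ν` in the
trinomial model with horizon `n`:
`P^ν(A) = Σ_{h+k≤n} ν(h,k) · P̃(A ∩ {U_n = h, M_n = k}) / P̃(U_n = h, M_n = k)`. -/
noncomputable def triPnu (n : ℕ) (p₁ p₂ p₃ : ℝ) (ν : ℕ → ℕ → ℝ) (A : Finset (Fin n → Fin 3)) : ℝ :=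
  ∑ h ∈ range (n + 1), ∑ k ∈ range (n + 1 - h),
    ν h k *
      (∑ ω ∈ A.filter (fun ω => upCount n n ω = h ∧ midCount n n ω = k),
        triWeight n p₁ p₂ p₃ ω) /
      (∑ ω ∈ univ.filter (fun ω => upCount n n ω = h ∧ midCount n n ω = k),
        triWeight n p₁ p₂ p₃ ω)

/-- Number of coordinates at which `f` takes the value `c`. -/
def valueCount {r : ℕ} (c : Fin 3) (f : Fin r → Fin 3) : ℕ :=
  ∑ x, if f x = c then 1 else 0

lemma valueCount_cons {r : ℕ} (c d : Fin 3) (f : Fin r → Fin 3) :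
    valueCount c (Fin.cons d f : Fin (r + 1) → Fin 3) =
      (if d = c then 1 else 0) + valueCount c f := by
  simp [valueCount, Fin.sum_univ_succ, -sum_boole]

lemma valueCount_append {m r : ℕ} (c : Fin 3) (u : Fin m → Fin 3) (v : Fin r → Fin 3) :
    valueCount c (Fin.append u v) = valueCount c u + valueCount c v := by
  simp [valueCount, Fin.sum_univ_add, -sum_boole]

lemma upCount_self (n : ℕ) (ω : Fin n → Fin 3) : upCount n n ω = valueCount 0 ω := by
  simp [upCount, valueCount]

lemma midCount_self (n : ℕ) (ω : Fin n → Fin 3) : midCount n n ω = valueCount 1 ω := by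
  simp [midCount, valueCount]

lemma upCount_append {m r : ℕ} (u : Fin m → Fin 3) (v : Fin r → Fin 3) :
    upCount (m + r) m (Fin.append u v) = valueCount 0 u := by
  simp [upCount, valueCount, card_filter, Fin.sum_univ_add, -sum_boole]

lemma midCount_append {m r : ℕ} (u : Fin m → Fin 3) (v : Fin r → Fin 3) :
    midCount (m + r) m (Fin.append u v) = valueCount 1 u := by
  simp [midCount, valueCount, card_filter, Fin.sum_univ_add, -sum_boole]

lemma card_filter_cons {r : ℕ} (P : (Fin (r + 1) → Fin 3) → Prop) [DecidablePred P] :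
    #{f : Fin (r + 1) → Fin 3 | P f} =
      ∑ d : Fin 3, #{f : Fin r → Fin 3 | P (Fin.cons d f)} := by
  simp only [card_filter]
  rw [← (Fin.consEquiv (fun _ => Fin 3)).sum_comp, Fintype.sum_prod_type]
  rfl

/-- Number of sequences of length `r` taking the value `0` exactly `a` times and the value `1`
exactly `b` times. -/
def pathCount (r a b : ℕ) : ℕ :=
  #{f : Fin r → Fin 3 | valueCount 0 f = a ∧ valueCount 1 f = b}

lemma pathCount_eq_choose (r a b : ℕ) :
    pathCount r a b = r.choose a * (r - a).choose b := by
  induction r generalizing a b with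
  | zero => cases a <;> cases b <;> simp [pathCount, valueCount]
  | succ r ih =>
    unfold pathCount at ih ⊢
    rw [card_filter_cons]
    simp only [Fin.sum_univ_three, valueCount_cons]
    rcases a with _ | a <;> rcases b with _ | b <;>
      simp [add_comm 1, ih, Nat.choose_succ_succ]
    rcases lt_or_ge a r with h | h
    · obtain ⟨t, rfl⟩ := Nat.exists_eq_add_of_lt h
      have h₁ : a + t + 1 - a = t + 1 := by omega
      have h₂ : a + t + 1 - (a + 1) = t := by omega
      simp only [h₁, h₂, Nat.choose_succ_succ]
      ring
    · simp [Nat.choose_eq_zero_of_lt (Nat.lt_succ_of_le h)]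

lemma pathCount_eq_triCoeff {r a b : ℕ} (h : a + b ≤ r) : pathCount r a b = triCoeff r a b := by
  rw [pathCount_eq_choose, triCoeff]
  symm
  apply Nat.div_eq_of_eq_mul_left (by positivity)
  rw [← Nat.choose_mul_factorial_mul_factorial (show a ≤ r by omega),
    ← Nat.choose_mul_factorial_mul_factorial (show b ≤ r - a by omega)]
  ring

lemma pathCount_eq_zero {r a b : ℕ} (h : r < a + b) : pathCount r a b = 0 := by
  rw [pathCount_eq_choose]
  rcases lt_or_ge r a with ha | ha
  · simp [Nat.choose_eq_zero_of_lt ha]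
  · simp [Nat.choose_eq_zero_of_lt (show r - a < b by omega)]

lemma card_filter_append {m r : ℕ} (i j h k : ℕ) (P : (Fin (m + r) → Fin 3) → Prop)
    (Q : (Fin r → Fin 3) → Prop) [DecidablePred P] [DecidablePred Q]
    (hPQ : ∀ u v, P (Fin.append u v) ↔ Q v) :
    #{ω : Fin (m + r) → Fin 3 | (P ω ∧ upCount (m + r) m ω = i ∧ midCount (m + r) m ω = j) ∧
        upCount (m + r) (m + r) ω = h ∧ midCount (m + r) (m + r) ω = k} =
      if i ≤ h ∧ j ≤ k then
        pathCount m i j * #{v : Fin r → Fin 3 |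
          Q v ∧ valueCount 0 v = h - i ∧ valueCount 1 v = k - j}
      else 0 := by
  have hcard : ∀ R : (Fin (m + r) → Fin 3) → Prop, ∀ [DecidablePred R],
      #{ω : Fin (m + r) → Fin 3 | R ω} =
        #{x : (Fin m → Fin 3) × (Fin r → Fin 3) | R (Fin.append x.1 x.2)} := by
    intro R _
    simp only [card_filter]
    exact ((Fin.appendEquiv m r).sum_comp _).symm
  rw [hcard]
  simp only [hPQ, upCount_append, midCount_append, upCount_self, midCount_self, valueCount_append]
  split_ifs with hh
  · rw [pathCount, ← card_product]
    congr 1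
    ext ⟨u, v⟩
    simp only [mem_filter, mem_univ, true_and, mem_product]
    constructor
    · rintro ⟨⟨hq, h1, h2⟩, h3, h4⟩
      exact ⟨⟨h1, h2⟩, hq, by omega, by omega⟩
    · rintro ⟨⟨h1, h2⟩, hq, h3, h4⟩
      exact ⟨⟨hq, h1, h2⟩, by omega, by omega⟩
  · rw [card_eq_zero, filter_eq_empty_iff]
    rintro ⟨u, v⟩ -
    simp only
    omega

lemma card_filter_first_up (r a b : ℕ) :
    #{v : Fin (r + 1) → Fin 3 | v 0 = 0 ∧ valueCount 0 v = a ∧ valueCount 1 v = b} =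
      if 1 ≤ a then pathCount r (a - 1) b else 0 := by
  rw [card_filter_cons]
  rcases a with _ | a <;> simp [Fin.sum_univ_three, valueCount_cons, pathCount, add_comm 1]

lemma triWeight_eq {n : ℕ} (p₁ p₂ p₃ : ℝ) (ω : Fin n → Fin 3) :
    triWeight n p₁ p₂ p₃ ω =
      p₁ ^ valueCount 0 ω * p₂ ^ valueCount 1 ω * p₃ ^ valueCount 2 ω := by
  simp only [triWeight, valueCount, ← prod_pow_eq_pow_sum, ← prod_mul_distrib]
  refine prod_congr rfl fun x _ => ?_
  generalize ω x = c
  fin_cases c <;> simp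

lemma valueCount_sum {n : ℕ} (ω : Fin n → Fin 3) :
    valueCount 0 ω + valueCount 1 ω + valueCount 2 ω = n := by
  simp only [valueCount, ← sum_add_distrib]
  rw [sum_congr rfl (g := fun _ => 1)]
  · simp
  · intro x _
    generalize ω x = c
    fin_cases c <;> simp

/-- Conditionally on the terminal counts, all paths have the same weight, so `P^ν` reduces to a
ratio of cardinalities. -/
lemma triPnu_eq {n : ℕ} {p₁ p₂ p₃ : ℝ} (hp₁ : 0 < p₁) (hp₂ : 0 < p₂) (hp₃ : 0 < p₃)
    (ν : ℕ → ℕ → ℝ) (A : (Fin n → Fin 3) → Prop) [DecidablePred A] :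
    triPnu n p₁ p₂ p₃ ν (univ.filter A) =
      ∑ h ∈ range (n + 1), ∑ k ∈ range (n + 1), if h + k ≤ n then
        ν h k * #{ω | A ω ∧ upCount n n ω = h ∧ midCount n n ω = k} / (triCoeff n h k : ℝ)
      else 0 := by
  rw [triPnu]
  refine sum_congr rfl fun h _ => ?_
  rw [← sum_filter]
  refine sum_congr ?_ fun k hk => ?_
  · ext k
    simp only [mem_range, mem_filter]
    omega
  have hk : h + k ≤ n := (mem_filter.mp hk).2
  have hw : ∀ B : Finset (Fin n → Fin 3),
      (∀ ω ∈ B, upCount n n ω = h ∧ midCount n n ω = k) →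
      ∑ ω ∈ B, triWeight n p₁ p₂ p₃ ω = #B * (p₁ ^ h * p₂ ^ k * p₃ ^ (n - h - k)) := by
    intro B hB
    rw [← nsmul_eq_mul]
    refine sum_eq_card_nsmul fun ω hω => ?_
    obtain ⟨h0, h1⟩ := hB ω hω
    rw [upCount_self] at h0
    rw [midCount_self] at h1
    have := valueCount_sum ω
    rw [triWeight_eq, h0, h1, show valueCount 2 ω = n - h - k by omega]
  rw [hw _ fun ω hω => (mem_filter.mp hω).2, hw _ fun ω hω => (mem_filter.mp hω).2,
    ← mul_assoc, mul_div_mul_right _ _ (by positivity), filter_filter, ← pathCount_eq_triCoeff hk]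
  simp only [pathCount, upCount_self, midCount_self]

/-- In the trinomial weak-information setup with horizon `n`, for `m < n` and `i + j ≤ m`
with `P^ν(U_m = i ∧ M_m = j) > 0`, the transition probability of an up-move is
`P^ν(ω(m) = 0 ∧ U_m = i ∧ M_m = j) / P^ν(U_m = i ∧ M_m = j)
  = [Σ ν(h,k) C(m;i,j) C(n-m-1;h-i-1,k-j)/C(n;h,k)] / [Σ ν(h,k) C(m;i,j) C(n-m;h-i,k-j)/C(n;h,k)]`. -/
theorem stmt_11 (n : ℕ) (p₁ p₂ p₃ : ℝ)
    (hp₁ : 0 < p₁) (hp₂ : 0 < p₂) (hp₃ : 0 < p₃) (hpsum : p₁ + p₂ + p₃ = 1)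
    (ν : ℕ → ℕ → ℝ) (hν_nonneg : ∀ h k, 0 ≤ ν h k)
    (hν_sum : ∑ h ∈ range (n + 1), ∑ k ∈ range (n + 1 - h), ν h k = 1)
    (m i j : ℕ) (hm : m < n) (hij : i + j ≤ m)
    (hpos : 0 < triPnu n p₁ p₂ p₃ ν
      (univ.filter (fun ω => upCount n m ω = i ∧ midCount n m ω = j))) :
    triPnu n p₁ p₂ p₃ ν
        (univ.filter (fun ω =>
          ω ⟨m, hm⟩ = 0 ∧ upCount n m ω = i ∧ midCount n m ω = j)) /
      triPnu n p₁ p₂ p₃ ν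
        (univ.filter (fun ω => upCount n m ω = i ∧ midCount n m ω = j)) =
    (∑ h ∈ range (n + 1), ∑ k ∈ range (n + 1),
        if i + 1 ≤ h ∧ j ≤ k ∧ h + k ≤ n ∧ (h - i - 1) + (k - j) ≤ n - m - 1 then
          ν h k * (triCoeff m i j * triCoeff (n - m - 1) (h - i - 1) (k - j) : ℝ) /
            (triCoeff n h k : ℝ)
        else 0) /
    (∑ h ∈ range (n + 1), ∑ k ∈ range (n + 1),
        if i ≤ h ∧ j ≤ k ∧ h + k ≤ n ∧ (h - i) + (k - j) ≤ n - m then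
          ν h k * (triCoeff m i j * triCoeff (n - m) (h - i) (k - j) : ℝ) /
            (triCoeff n h k : ℝ)
        else 0) := by
  obtain ⟨r, rfl⟩ : ∃ r, n = m + (r + 1) := ⟨n - m - 1, by omega⟩
  congr 1
  · rw [triPnu_eq hp₁ hp₂ hp₃]
    refine sum_congr rfl fun h _ => sum_congr rfl fun k _ => ?_
    rw [card_filter_append i j h k (fun ω => ω ⟨m, hm⟩ = 0) (fun v => v 0 = 0),
      card_filter_first_up, show m + (r + 1) - m - 1 = r by omega]
    · by_cases hc : i + 1 ≤ h ∧ j ≤ k ∧ h + k ≤ m + (r + 1) ∧ h - i - 1 + (k - j) ≤ r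
      · rw [if_pos hc, if_pos (by omega), if_pos (by omega), if_pos (by omega),
          pathCount_eq_triCoeff hij, pathCount_eq_triCoeff hc.2.2.2, Nat.cast_mul]
      · rw [if_neg hc]
        split_ifs <;> first | rfl | simp
        rw [pathCount_eq_zero (r := r) (by omega)]
        simp
    · intro u v
      rw [show (⟨m, hm⟩ : Fin (m + (r + 1))) = Fin.natAdd m 0 from Fin.ext rfl, Fin.append_right]
  · rw [triPnu_eq hp₁ hp₂ hp₃]
    refine sum_congr rfl fun h _ => sum_congr rfl fun k _ => ?_
    have hcard := card_filter_append (m := m) (r := r + 1) i j h k (fun _ => True) (fun _ => True)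
      (fun _ _ => Iff.rfl)
    simp only [true_and] at hcard
    rw [← pathCount] at hcard
    rw [hcard, show m + (r + 1) - m = r + 1 by omega]
    by_cases hc : i ≤ h ∧ j ≤ k ∧ h + k ≤ m + (r + 1) ∧ h - i + (k - j) ≤ r + 1
    · rw [if_pos hc, if_pos (by omega), if_pos (by omega),
        pathCount_eq_triCoeff hij, pathCount_eq_triCoeff hc.2.2.2, Nat.cast_mul]
    · rw [if_neg hc]
      split_ifs <;> first | rfl | simp
      rw [pathCount_eq_zero (r := r + 1) (by omega)]
      simp
end

section
/- Let X be a Polish space, let (P_n)_{n≥1} be Borel probability measures on X converging weakly to a Borel probability measure P, and let ξ_n, ξ : X → [0,∞) be continuous functions with sup_{n≥1} ‖ξ_n‖_∞ < ∞, ξ bounded, and ξ_n → ξ uniformly on every compact subset of X. Let α ∈ (0,1) and x > 0. Then the power-utility financial values of weak information converge: (x^α/α)·(∫_X ξ_n(y)^{1/(1-α)} P_n(dy))^{1-α} → (x^α/α)·(∫_X ξ(y)^{1/(1-α)} P(dy))^{1-α} as n → ∞. -/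
open MeasureTheory Filter Topology

/-- A weakly convergent sequence of probability measures on a Polish space is tight. -/
lemma MeasureTheory.ProbabilityMeasure.isTightMeasureSet_range_of_tendsto
    {X : Type*} [TopologicalSpace X] [PolishSpace X] [MeasurableSpace X] [BorelSpace X]
    {μ : ℕ → ProbabilityMeasure X} {μ₀ : ProbabilityMeasure X} (hμ : Tendsto μ atTop (𝓝 μ₀)) :
    IsTightMeasureSet (Set.range fun n => (μ n : Measure X)) := by
  let := TopologicalSpace.upgradeIsCompletelyMetrizable X
  have hcomp : IsCompact (closure (Set.range μ)) :=
    hμ.isCompact_insert_range.closure_of_subset (Set.subset_insert _ _)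
  refine (isTightMeasureSet_of_isCompact_closure hcomp).subset ?_
  rintro _ ⟨n, rfl⟩
  exact ⟨μ n, ⟨n, rfl⟩, rfl⟩

/-- Along a weakly convergent sequence of probability measures on a Polish space, the integrals of
uniformly bounded continuous functions converging uniformly on compact sets converge. -/
lemma MeasureTheory.ProbabilityMeasure.tendsto_integral_of_tendstoUniformlyOn_isCompact
    {X : Type*} [TopologicalSpace X] [PolishSpace X] [MeasurableSpace X] [BorelSpace X]
    {μ : ℕ → ProbabilityMeasure X} {μ₀ : ProbabilityMeasure X} (hμ : Tendsto μ atTop (𝓝 μ₀))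
    {f : ℕ → X → ℝ} {f₀ : X → ℝ} (hf : ∀ n, Continuous (f n)) (hf₀ : Continuous f₀)
    {C : ℝ} (hfC : ∀ n y, |f n y| ≤ C) (hf₀C : ∀ y, |f₀ y| ≤ C)
    (hunif : ∀ K : Set X, IsCompact K → TendstoUniformlyOn f f₀ atTop K) :
    Tendsto (fun n => ∫ y, f n y ∂(μ n : Measure X)) atTop (𝓝 (∫ y, f₀ y ∂(μ₀ : Measure X))) := by
  have hweak : Tendsto (fun n => ∫ y, f₀ y ∂(μ n : Measure X)) atTop
      (𝓝 (∫ y, f₀ y ∂(μ₀ : Measure X))) :=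
    ProbabilityMeasure.tendsto_iff_forall_integral_tendsto.1 hμ
      (BoundedContinuousFunction.ofNormedAddCommGroup f₀ hf₀ C hf₀C)
  have hint (n : ℕ) : Integrable (f n) (μ n : Measure X) :=
    .of_bound (hf n).aestronglyMeasurable C (.of_forall (hfC n))
  have hint₀ (n : ℕ) : Integrable f₀ (μ n : Measure X) :=
    .of_bound hf₀.aestronglyMeasurable C (.of_forall hf₀C)
  have hC : 0 ≤ C := by
    obtain ⟨y⟩ := (μ 0).nonempty
    exact (abs_nonneg _).trans (hf₀C y)
  suffices hdiff : Tendsto (fun n => ∫ y, (f n y - f₀ y) ∂(μ n : Measure X)) atTop (𝓝 0) by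
    have := hdiff.add hweak
    rw [zero_add] at this
    refine this.congr fun n => ?_
    rw [integral_sub (hint n) (hint₀ n), sub_add_cancel]
  rw [Metric.tendsto_nhds]
  intro ε hε
  have hδ : 0 < ε / (2 * (2 * C + 1)) := by positivity
  obtain ⟨K, hK, hKμ⟩ := isTightMeasureSet_iff_exists_isCompact_measure_compl_le.1
    (isTightMeasureSet_range_of_tendsto hμ) (ENNReal.ofReal (ε / (2 * (2 * C + 1))))
    (ENNReal.ofReal_pos.2 hδ)
  filter_upwards [Metric.tendstoUniformlyOn_iff.1 (hunif K hK) (ε / 2) (half_pos hε)] with n hn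
  have hKc : MeasurableSet Kᶜ := hK.isClosed.measurableSet.compl
  have hKn : (μ n : Measure X).real Kᶜ ≤ ε / (2 * (2 * C + 1)) :=
    ENNReal.toReal_le_of_le_ofReal hδ.le (hKμ _ ⟨n, rfl⟩)
  have hbound : Integrable (fun y => ε / 2 + Kᶜ.indicator (fun _ => 2 * C) y) (μ n : Measure X) :=
    (integrable_const _).add ((integrable_const _).indicator hKc)
  rw [dist_zero_right]
  calc ‖∫ y, (f n y - f₀ y) ∂(μ n : Measure X)‖
      ≤ ∫ y, (ε / 2 + Kᶜ.indicator (fun _ => 2 * C) y) ∂(μ n : Measure X) := by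
        refine norm_integral_le_of_norm_le hbound (.of_forall fun y => ?_)
        by_cases hy : y ∈ K
        · have := hn y hy
          rw [dist_comm, dist_eq_norm] at this
          simpa [hy] using this.le
        · have := norm_sub_le (f n y) (f₀ y)
          have h₁ := hfC n y
          have h₂ := hf₀C y
          simp only [Real.norm_eq_abs] at this ⊢
          rw [Set.indicator_of_mem (by simpa using hy)]
          linarith
    _ = ε / 2 + (μ n : Measure X).real Kᶜ * (2 * C) := by
        rw [integral_add (integrable_const _) ((integrable_const _).indicator hKc),
          integral_indicator_const _ hKc]
        simp
    _ ≤ ε / 2 + ε / (2 * (2 * C + 1)) * (2 * C) := by gcongr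
    _ < ε := by
        have : ε / (2 * (2 * C + 1)) * (2 * C + 1) = ε / 2 := by field_simp
        linarith

/-- Convergence of the power-utility (`U(x) = x^α/α`) financial values of weak information:
`(x^α/α)·(∫ ξ_n^{1/(1-α)} dP_n)^{1-α} → (x^α/α)·(∫ ξ^{1/(1-α)} dP)^{1-α}`. -/
theorem stmt_15 {X : Type*} [TopologicalSpace X] [PolishSpace X]
    [MeasurableSpace X] [BorelSpace X]
    (P : ℕ → Measure X) (P₀ : Measure X)
    [∀ n, IsProbabilityMeasure (P n)] [IsProbabilityMeasure P₀]
    (hweak : ∀ g : BoundedContinuousFunction X ℝ,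
      Tendsto (fun n => ∫ y, g y ∂(P n)) atTop (𝓝 (∫ y, g y ∂P₀)))
    (ξ : ℕ → X → ℝ) (ξ₀ : X → ℝ)
    (hξ_nonneg : ∀ n y, 0 ≤ ξ n y) (hξ₀_nonneg : ∀ y, 0 ≤ ξ₀ y)
    (hξ_cont : ∀ n, Continuous (ξ n)) (hξ₀_cont : Continuous ξ₀)
    (B : ℝ) (hξ_bdd : ∀ n y, ξ n y ≤ B) (hξ₀_bdd : ∀ y, ξ₀ y ≤ B)
    (hunif : ∀ K : Set X, IsCompact K → TendstoUniformlyOn (fun n y => ξ n y) ξ₀ atTop K)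
    (α : ℝ) (hα0 : 0 < α) (hα1 : α < 1) (x : ℝ) (hx : 0 < x) :
    Tendsto
      (fun n => x ^ α / α * (∫ y, ξ n y ^ (1 / (1 - α)) ∂(P n)) ^ (1 - α)) atTop
      (𝓝 (x ^ α / α * (∫ y, ξ₀ y ^ (1 / (1 - α)) ∂P₀) ^ (1 - α))) := by
  have hexp : 0 ≤ 1 / (1 - α) := one_div_nonneg.2 (sub_nonneg.2 hα1.le)
  have hpow : UniformContinuousOn (fun t : ℝ => t ^ (1 / (1 - α))) (Set.Icc 0 B) :=
    isCompact_Icc.uniformContinuousOn_of_continuous (Real.continuous_rpow_const hexp).continuousOn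
  let μ (n : ℕ) : ProbabilityMeasure X := ⟨P n, inferInstance⟩
  let μ₀ : ProbabilityMeasure X := ⟨P₀, inferInstance⟩
  have hμ : Tendsto μ atTop (𝓝 μ₀) :=
    ProbabilityMeasure.tendsto_iff_forall_integral_tendsto.2 hweak
  have hbound {t : ℝ} (h0 : 0 ≤ t) (hB : t ≤ B) : |t ^ (1 / (1 - α))| ≤ B ^ (1 / (1 - α)) := by
    rw [abs_of_nonneg (Real.rpow_nonneg h0 _)]
    exact Real.rpow_le_rpow h0 hB hexp
  have hlim := ProbabilityMeasure.tendsto_integral_of_tendstoUniformlyOn_isCompact hμ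
    (fun n => (hξ_cont n).rpow_const fun _ => Or.inr hexp)
    (hξ₀_cont.rpow_const fun _ => Or.inr hexp)
    (fun n y => hbound (hξ_nonneg n y) (hξ_bdd n y))
    (fun y => hbound (hξ₀_nonneg y) (hξ₀_bdd y))
    (fun K hK => hpow.comp_tendstoUniformlyOn_eventually
      (.of_forall fun n y _ => Set.mem_Icc.2 ⟨hξ_nonneg n y, hξ_bdd n y⟩)
      (fun y _ => Set.mem_Icc.2 ⟨hξ₀_nonneg y, hξ₀_bdd y⟩) (hunif K hK))
  exact (hlim.rpow_const (Or.inr (sub_nonneg.2 hα1.le))).const_mul _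
end
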